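/- arXiv:2006.10711 — 2 statements merged into one kernel-verified Lean document; each statement's English description precedes it below -/
import Mathlib

section
/- Let f : ℝ × ℝ → ℝ be continuous, satisfy the Lipschitz condition |f(s, x₂) - f(s, x₁)| ≤ L·|x₂ - x₁| for all s, x₁, x₂ with 0 ≤ L < ∞, and satisfy |f(s, x)| ≤ M for all (s, x) with 0 ≤ M < ∞. Let φ₁, φ₂ : ℝ → ℝ be continuous, let z₀, t₀ ∈ ℝ, let δ₁, δ₂ ∈ ℝ, and suppose sup_s |φ₂(s) - φ₁(s)| ≤ Δ for some Δ ≥ 0. Then for every t ∈ ℝ, |T_{δ₂}[φ₂](t) - T_{δ₁}[φ₁](t)| ≤ L·|t + δ₁ - t₀|·Δ + M·|δ₂ - δ₁|. -/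
open MeasureTheory intervalIntegral

/-- The modified Picard operator of STEER: given `f : ℝ × ℝ → ℝ`, an initial value `z₀`,
an initial time `t₀`, and an end-time perturbation `δ`, it maps `φ : ℝ → ℝ` to
`t ↦ z₀ + ∫_{t₀}^{t+δ} f(s, φ(s)) ds`. -/
noncomputable def picardT (f : ℝ × ℝ → ℝ) (z₀ t₀ δ : ℝ) (φ : ℝ → ℝ) (t : ℝ) : ℝ :=
  z₀ + ∫ s in t₀..(t + δ), f (s, φ s)

/-- Central estimate of the contraction lemma: if `f` is `L`-Lipschitz in its second
argument, bounded by `M`, and `|φ₂ - φ₁| ≤ Δ` uniformly, then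
`|T_{δ₂}[φ₂](t) - T_{δ₁}[φ₁](t)| ≤ L·|t + δ₁ - t₀|·Δ + M·|δ₂ - δ₁|`. -/
theorem picardT_contraction_estimate (f : ℝ × ℝ → ℝ) (hf : Continuous f)
    (L : ℝ) (hL : 0 ≤ L)
    (hLip : ∀ s x₁ x₂ : ℝ, |f (s, x₂) - f (s, x₁)| ≤ L * |x₂ - x₁|)
    (M : ℝ) (hM : 0 ≤ M) (hfM : ∀ s x : ℝ, |f (s, x)| ≤ M)
    (φ₁ φ₂ : ℝ → ℝ) (hφ₁ : Continuous φ₁) (hφ₂ : Continuous φ₂)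
    (z₀ t₀ δ₁ δ₂ : ℝ) (Δ : ℝ) (hΔ : 0 ≤ Δ)
    (hsup : ∀ s : ℝ, |φ₂ s - φ₁ s| ≤ Δ) :
    ∀ t : ℝ, |picardT f z₀ t₀ δ₂ φ₂ t - picardT f z₀ t₀ δ₁ φ₁ t| ≤
      L * |t + δ₁ - t₀| * Δ + M * |δ₂ - δ₁| := by
  intro t
  have hc₁ : Continuous fun s => f (s, φ₁ s) := by fun_prop
  have hc₂ : Continuous fun s => f (s, φ₂ s) := by fun_prop
  have hsplit : picardT f z₀ t₀ δ₂ φ₂ t - picardT f z₀ t₀ δ₁ φ₁ t =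
      (∫ s in t₀..(t + δ₁), (f (s, φ₂ s) - f (s, φ₁ s))) +
        ∫ s in (t + δ₁)..(t + δ₂), f (s, φ₂ s) := by
    rw [picardT, picardT, integral_sub (hc₂.intervalIntegrable _ _) (hc₁.intervalIntegrable _ _),
      ← integral_add_adjacent_intervals (hc₂.intervalIntegrable t₀ (t + δ₁))
        (hc₂.intervalIntegrable (t + δ₁) (t + δ₂))]
    ring
  have hLipschitz : ‖∫ s in t₀..(t + δ₁), (f (s, φ₂ s) - f (s, φ₁ s))‖ ≤
      L * Δ * |t + δ₁ - t₀| :=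
    norm_integral_le_of_norm_le_const fun s _ =>
      (hLip s _ _).trans (mul_le_mul_of_nonneg_left (hsup s) hL)
  have hEndpoint : ‖∫ s in (t + δ₁)..(t + δ₂), f (s, φ₂ s)‖ ≤ M * |t + δ₂ - (t + δ₁)| :=
    norm_integral_le_of_norm_le_const fun s _ => hfM s _
  rw [add_sub_add_left_eq_sub] at hEndpoint
  rw [hsplit, mul_right_comm]
  exact (abs_add_le _ _).trans (add_le_add hLipschitz hEndpoint)
end

section
/- Let f : ℝ × ℝ → ℝ be continuous, satisfy |f(s, x₂) - f(s, x₁)| ≤ L·|x₂ - x₁| for all s, x₁, x₂ with 0 ≤ L < ∞, and let z₀, t₀, δ ∈ ℝ and a > 0 with L·(a + |δ|) < 1. Then for all continuous φ₁, φ₂ : ℝ → ℝ, sup_{t ∈ [t₀-a, t₀+a]} |T_δ[φ₂](t) - T_δ[φ₁](t)| ≤ L·(a + |δ|) · sup_{s ∈ [t₀-a-|δ|, t₀+a+|δ|]} |φ₂(s) - φ₁(s)|; in particular, for fixed δ the operator T_δ contracts the supremum distance between functions defined on the corresponding interval. -/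
open MeasureTheory intervalIntegral

/-- Deterministic (fixed `δ`) contraction: if `f` is `L`-Lipschitz in its second argument
and `L·(a + |δ|) < 1`, then for continuous `φ₁, φ₂`, the sup distance of `T_δ[φ₂]` and
`T_δ[φ₁]` over `[t₀ - a, t₀ + a]` is at most `L·(a + |δ|)` times the sup distance of
`φ₂` and `φ₁` over `[t₀ - a - |δ|, t₀ + a + |δ|]`. -/
theorem picardT_fixed_delta_contraction (f : ℝ × ℝ → ℝ) (hf : Continuous f)
    (L : ℝ) (hL : 0 ≤ L)
    (hLip : ∀ s x₁ x₂ : ℝ, |f (s, x₂) - f (s, x₁)| ≤ L * |x₂ - x₁|)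
    (z₀ t₀ δ a : ℝ) (ha : 0 < a) (hcontr : L * (a + |δ|) < 1) :
    ∀ φ₁ φ₂ : ℝ → ℝ, Continuous φ₁ → Continuous φ₂ →
      sSup ((fun t => |picardT f z₀ t₀ δ φ₂ t - picardT f z₀ t₀ δ φ₁ t|) ''
          Set.Icc (t₀ - a) (t₀ + a)) ≤
        L * (a + |δ|) *
          sSup ((fun s => |φ₂ s - φ₁ s|) '' Set.Icc (t₀ - a - |δ|) (t₀ + a + |δ|)) := by
  intro φ₁ φ₂ h₁ h₂
  set I := Set.Icc (t₀ - a - |δ|) (t₀ + a + |δ|)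
  set M := sSup ((fun s => |φ₂ s - φ₁ s|) '' I)
  have hM : ∀ s ∈ I, |φ₂ s - φ₁ s| ≤ M := fun s hs =>
    le_csSup (isCompact_Icc.image (h₂.sub h₁).abs).bddAbove (Set.mem_image_of_mem _ hs)
  have ht₀ : t₀ ∈ I := by
    constructor <;> linarith [abs_nonneg δ]
  have hM₀ : 0 ≤ M := (abs_nonneg _).trans (hM t₀ ht₀)
  have hint : ∀ φ : ℝ → ℝ, Continuous φ → ∀ b c : ℝ,
      IntervalIntegrable (fun s => f (s, φ s)) volume b c := fun φ hφ b c =>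
    (hf.comp (continuous_id.prodMk hφ)).intervalIntegrable b c
  refine csSup_le ((Set.nonempty_Icc.2 (by linarith)).image _) ?_
  rintro _ ⟨t, ht, rfl⟩
  have htδ : t + δ ∈ I := by
    constructor <;> linarith [ht.1, ht.2, neg_abs_le δ, le_abs_self δ]
  have hlen : |t + δ - t₀| ≤ a + |δ| := by
    rw [abs_le]
    constructor <;> linarith [htδ.1, htδ.2]
  have hbound : ∀ s ∈ Set.uIoc t₀ (t + δ), ‖f (s, φ₂ s) - f (s, φ₁ s)‖ ≤ L * M := by
    intro s hs
    have hsI : s ∈ I := Set.uIcc_subset_Icc ht₀ htδ (Set.uIoc_subset_uIcc hs)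
    exact (hLip s _ _).trans (mul_le_mul_of_nonneg_left (hM s hsI) hL)
  calc |picardT f z₀ t₀ δ φ₂ t - picardT f z₀ t₀ δ φ₁ t|
      = ‖∫ s in t₀..(t + δ), (f (s, φ₂ s) - f (s, φ₁ s))‖ := by
        rw [integral_sub (hint φ₂ h₂ _ _) (hint φ₁ h₁ _ _), Real.norm_eq_abs, picardT, picardT,
          add_sub_add_left_eq_sub]
    _ ≤ L * M * |t + δ - t₀| := norm_integral_le_of_norm_le_const hbound
    _ ≤ L * M * (a + |δ|) := by gcongr
    _ = L * (a + |δ|) * M := by ring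
end
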